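/- arXiv:2412.14931 — 4 statements merged into one kernel-verified Lean document; each statement's English description precedes it below -/
import Mathlib

section
/- Let K be a field of characteristic zero, let Y be a variety over K whose set of K-rational points Y(K) is dense in Y, and let X be a quasi-projective variety over K. Let (φ_i : Y → X)_{i ∈ I} be a family of K-morphisms. Suppose that there is a K-rational point y_0 ∈ Y(K) such that the set {φ_i(y_0) | i ∈ I} is dense in X. Then the set of K-rational points of Y ×_K X lying on some graph Γ_{φ_i}, i.e., the set of points of the form (y, φ_i(y)) with y ∈ Y(K) and i ∈ I, is dense in Y ×_K X. -/
open AlgebraicGeometry CategoryTheory CategoryTheory.Limits MvPolynomial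

attribute [local instance] MvPolynomial.gradedAlgebra

/-- Projective `n`-space over a ring `k`, as `Proj` of the standard-graded polynomial ring. -/
noncomputable def ProjSpace (k : Type) [CommRing k] (n : ℕ) : Scheme :=
  Proj (homogeneousSubmodule (Fin n) k)

/-- The structure morphism `ℙⁿ_k ⟶ Spec k`. -/
noncomputable def ProjSpace.structMap (k : Type) [CommRing k] (n : ℕ) :
    ProjSpace k n ⟶ Spec (CommRingCat.of k) :=
  Proj.toSpecZero (homogeneousSubmodule (Fin n) k) ≫
    Spec.map (CommRingCat.ofHom
      ((GradedRing.projZeroRingHom' (homogeneousSubmodule (Fin n) k)).comp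
        (C : k →+* MvPolynomial (Fin n) k)))

section Aux

open TensorProduct


theorem core_lemma {K B R I κ : Type*} [Field K] [CommRing B] [CommRing R] [Algebra K B]
    [Algebra K R] [IsDomain R] [IsNoetherianRing R] (ε : R →ₐ[K] K) (ψ : I → B →ₐ[K] R)
    (hψ : ∀ b : B, b ≠ 0 → ∃ i, ε (ψ i b) ≠ 0) (b : κ → B) (hb : LinearIndependent K b)
    (s : Finset κ) (r : κ → R) (h : ∀ i, ∑ k ∈ s, r k * ψ i (b k) = 0) :
    ∀ k ∈ s, r k = 0 := by
  set m : Ideal R := RingHom.ker ε with hm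
  have hm1 : m ≠ ⊤ := RingHom.ker_ne_top _
  have key : ∀ d : ℕ, ∀ k ∈ s, r k ∈ m ^ d := by
    intro d
    induction d with
    | zero => intro k _; simp
    | succ d ih =>
      intro k hk
      by_contra hn
      obtain ⟨l, hl, hle⟩ := Submodule.exists_le_ker_of_notMem
        (p := (m ^ (d + 1)).restrictScalars K) (v := r k) (by simpa using hn)
      have h1 : ∀ i, l (∑ k ∈ s, ε (ψ i (b k)) • r k) = 0 := by
        intro i
        have : (∑ k ∈ s, ε (ψ i (b k)) • r k) ∈ (m ^ (d + 1)).restrictScalars K := by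
          have e1 : (∑ k ∈ s, ε (ψ i (b k)) • r k) =
              ∑ k ∈ s, r k * (algebraMap K R (ε (ψ i (b k))) - ψ i (b k)) := by
            simp only [mul_sub, Finset.sum_sub_distrib, h i, sub_zero]
            exact Finset.sum_congr rfl fun k _ => by rw [Algebra.smul_def, mul_comm]
          rw [e1]
          refine Submodule.sum_mem _ fun k hk => ?_
          rw [Submodule.restrictScalars_mem, pow_succ]
          refine Ideal.mul_mem_mul (ih k hk) ?_
          rw [hm, RingHom.mem_ker]
          simp
        exact hle this
      have h2 : ∑ k ∈ s, l (r k) • b k = 0 := by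
        by_contra h0
        obtain ⟨i, hi⟩ := hψ _ h0
        apply hi
        have := h1 i
        simp only [map_sum, map_smul, smul_eq_mul] at this ⊢
        rw [← this]
        exact Finset.sum_congr rfl fun k _ => mul_comm _ _
      exact hl (linearIndependent_iff'.mp hb s _ h2 k hk)
  intro k hk
  have : r k ∈ (⨅ d : ℕ, m ^ d) := by
    simp only [Submodule.mem_iInf]
    exact fun d => key d k hk
  rwa [Ideal.iInf_pow_eq_bot_of_isDomain m hm1] at this

theorem alg_lemma {K A B R L I : Type*} [Field K] [CommRing A] [CommRing B] [CommRing R]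
    [CommRing L] [Algebra K A] [Algebra K B] [Algebra K R] [Algebra K L] [Algebra R L]
    [IsFractionRing R L] [IsDomain R] [IsNoetherianRing R] (ε : R →ₐ[K] K)
    (ψ : I → B →ₐ[K] R) (hψ : ∀ b : B, b ≠ 0 → ∃ i, ε (ψ i b) ≠ 0)
    (j : A →ₐ[K] L) (hj : Function.Injective j)
    (θ : I → (A ⊗[K] B →+* L)) (hθ : ∀ i a b, θ i (a ⊗ₜ b) = j a * algebraMap R L (ψ i b))
    (F : A ⊗[K] B) (hF : F ≠ 0) : ∃ i, θ i F ≠ 0 := by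
  by_contra! H
  apply hF
  let b := Module.Basis.ofVectorSpace K B
  let bb := Algebra.TensorProduct.basis A b
  have hsum : F = ∑ k ∈ (bb.repr F).support, (bb.repr F k) ⊗ₜ[K] b k := by
    conv_lhs => rw [← bb.linearCombination_repr F]
    rw [Finsupp.linearCombination_apply, Finsupp.sum]
    refine Finset.sum_congr rfl fun k _ => ?_
    simp [bb, Algebra.TensorProduct.basis_apply, TensorProduct.smul_tmul']
  obtain ⟨c, hc⟩ := IsLocalization.exist_integer_multiples (nonZeroDivisors R)
    (bb.repr F).support (fun k => j (bb.repr F k))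
  choose! r hr using hc
  have hinj : Function.Injective (algebraMap R L) := IsFractionRing.injective R L
  have h0 := core_lemma ε ψ hψ b b.linearIndependent (bb.repr F).support r (by
    intro i
    apply hinj
    have := H i
    rw [hsum, map_sum] at this
    simp only [hθ] at this
    rw [map_sum, map_zero, ← mul_zero (algebraMap R L c), ← this, Finset.mul_sum]
    refine Finset.sum_congr rfl fun k hk => ?_
    rw [map_mul, hr k hk, Algebra.smul_def, mul_assoc])
  rw [hsum]
  refine Finset.sum_eq_zero fun k hk => ?_
  have h1 := hr k hk
  rw [h0 k hk, map_zero, Algebra.smul_def] at h1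
  have hu : IsUnit (algebraMap R L c) := IsLocalization.map_units L c
  have h2 : j (bb.repr F k) = 0 := (hu.mul_right_eq_zero).mp h1.symm
  rw [hj (h2.trans (map_zero j).symm), TensorProduct.zero_tmul]

theorem mid_lemma (K : Type) [Field K] (A B R L : CommRingCat.{0}) [IsDomain R]
    [IsNoetherianRing R] [Algebra R L] [IsFractionRing R L]
    (fA : CommRingCat.of K ⟶ A) (fB : CommRingCat.of K ⟶ B) (fR : CommRingCat.of K ⟶ R)
    (ε : R ⟶ CommRingCat.of K) (hε : fR ≫ ε = 𝟙 _) {J : Type} (ψ : J → (B ⟶ R))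
    (hψK : ∀ i, fB ≫ ψ i = fR) (hψ : ∀ b : B, b ≠ 0 → ∃ i, ε (ψ i b) ≠ 0)
    (j : A ⟶ L) (hj : Function.Injective j)
    (e : R ⟶ L) (he : e = CommRingCat.ofHom (algebraMap R L))
    (hjK : fA ≫ j = fR ≫ e)
    (W : Set (pullback (Spec.map fA) (Spec.map fB) : Scheme)) (hW : IsOpen W)
    (hne : W.Nonempty) :
    ∃ (i : J) (t : Spec L ⟶ pullback (Spec.map fA) (Spec.map fB)),
      t ≫ pullback.fst _ _ = Spec.map j ∧
      t ≫ pullback.snd _ _ = Spec.map (ψ i ≫ e) ∧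
      ∃ x, t x ∈ W := by
  subst he
  let _ : Algebra K A := fA.hom.toAlgebra
  let _ : Algebra K B := fB.hom.toAlgebra
  let _ : Algebra K R := fR.hom.toAlgebra
  let _ : Algebra K L := (fA ≫ j).hom.toAlgebra
  let ε' : R →ₐ[K] K := { ε.hom with
    commutes' := fun k => ConcreteCategory.congr_hom hε k }
  let ψ' : J → (B →ₐ[K] R) := fun i => { (ψ i).hom with
    commutes' := fun k => ConcreteCategory.congr_hom (hψK i) k }
  let j' : A →ₐ[K] L := { j.hom with commutes' := fun k => rfl }
  let e' : R →ₐ[K] L := { algebraMap R L with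
    commutes' := fun k => ConcreteCategory.congr_hom hjK.symm k }
  let θ : J → (A ⊗[K] B →ₐ[K] L) := fun i =>
    Algebra.TensorProduct.lift j' (e'.comp (ψ' i)) (fun _ _ => Commute.all _ _)
  have hL : IsDomain L := IsFractionRing.isDomain R
  let E : pullback (Spec.map fA) (Spec.map fB) ≅ Spec (.of (A ⊗[K] B)) := pullbackSpecIso K A B
  have hE1 : E.inv ≫ pullback.fst _ _ =
    Spec.map (CommRingCat.ofHom Algebra.TensorProduct.includeLeftRingHom) :=
      pullbackSpecIso_inv_fst K A B
  have hE2 : E.inv ≫ pullback.snd _ _ = Spec.map (CommRingCat.ofHom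
      (R := B) (S := A ⊗[K] B) (AlgHom.toRingHom Algebra.TensorProduct.includeRight)) :=
      pullbackSpecIso_inv_snd K A B
  have hW' : IsOpen (E.inv ⁻¹' W) := hW.preimage E.inv.continuous
  obtain ⟨w, hw⟩ := hne
  have hw' : E.hom w ∈ E.inv ⁻¹' W := by
    simpa using hw
  obtain ⟨_, ⟨_, ⟨F, rfl⟩, rfl⟩, hF1, hF2⟩ :=
    PrimeSpectrum.isBasis_basic_opens.exists_subset_of_mem_open hw' hW'
  have hF0 : F ≠ 0 := by
    rintro rfl
    rw [PrimeSpectrum.basicOpen_zero] at hF1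
    exact hF1
  obtain ⟨i, hi⟩ := alg_lemma ε' ψ' hψ j' hj (fun i => (θ i).toRingHom)
    (fun i a b => by
      change θ i (a ⊗ₜ b) = _
      simp only [θ, Algebra.TensorProduct.lift_tmul]; rfl) F hF0
  refine ⟨i, Spec.map (CommRingCat.ofHom (θ i).toRingHom) ≫ E.inv, ?_, ?_, ?_⟩
  · rw [Category.assoc, hE1, ← Spec.map_comp]
    congr 1
    ext a
    change θ i (a ⊗ₜ 1) = _
    simp only [θ, Algebra.TensorProduct.lift_tmul, map_one, mul_one]; rfl
  · rw [Category.assoc, hE2, ← Spec.map_comp]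
    congr 1
    ext a
    change θ i (1 ⊗ₜ a) = _
    simp only [θ, Algebra.TensorProduct.lift_tmul, map_one, one_mul]; rfl
  · let x0 : Spec L := (⊥ : PrimeSpectrum L)
    refine ⟨x0, ?_⟩
    have hx : F ∉ ((PrimeSpectrum.comap (θ i).toRingHom) ⊥).asIdeal := by
      simpa using hi
    exact hF2 (show Spec.map (CommRingCat.ofHom (θ i).toRingHom) x0 ∈ _ from hx)

end Aux

/-- Let `K` be a field of characteristic zero, `Y` a variety over `K` with
`Y(K)` dense, and `X` a quasi-projective variety over `K`. Given a family of `K`-morphisms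
`φ i : Y ⟶ X` and a `K`-rational point `p₀ ∈ Y(K)` whose images `φ i (p₀)` are dense in `X`,
the set of `K`-rational points of `Y ×_K X` of the form `(y, φ i y)` with `y ∈ Y(K)` is dense
in `Y ×_K X`. -/
theorem stmt1 (K : Type) [Field K] [CharZero K]
    (Y X : Scheme) [IsIntegral Y] [IsIntegral X]
    (πY : Y ⟶ Spec (CommRingCat.of K)) (πX : X ⟶ Spec (CommRingCat.of K))
    [LocallyOfFiniteType πY] [QuasiCompact πY] [IsSeparated πY]
    [LocallyOfFiniteType πX] [QuasiCompact πX] [IsSeparated πX]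
    -- `X` is quasi-projective over `K`: it admits a locally closed immersion into some `ℙⁿ_K`
    (n : ℕ) (ι : X ⟶ ProjSpace K n) (hι : IsImmersion ι)
    (hιπ : ι ≫ ProjSpace.structMap K n = πX)
    -- `Y(K)` is dense in `Y`
    (hYK : Dense {y : Y | ∃ p : Spec (CommRingCat.of K) ⟶ Y,
      p ≫ πY = 𝟙 (Spec (CommRingCat.of K)) ∧ ∃ s, p.base s = y})
    (I : Type) (φ : I → (Y ⟶ X)) (hφ : ∀ i, φ i ≫ πX = πY)
    -- a `K`-rational point `y₀` of `Y` whose images under the `φ i` are dense in `X`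
    (p₀ : Spec (CommRingCat.of K) ⟶ Y) (hp₀ : p₀ ≫ πY = 𝟙 (Spec (CommRingCat.of K)))
    (hy₀ : Dense {x : X | ∃ (i : I) (s : Spec (CommRingCat.of K)),
      (p₀ ≫ φ i).base s = x}) :
    Dense {z : (pullback πY πX : Scheme) |
      ∃ (i : I) (p : Spec (CommRingCat.of K) ⟶ Y),
        p ≫ πY = 𝟙 (Spec (CommRingCat.of K)) ∧
        ∃ s, (p ≫ (pullback.lift (𝟙 Y) (φ i)
          (by rw [Category.id_comp, hφ i]) : Y ⟶ pullback πY πX)).base s = z} := by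
  rw [dense_iff_inter_open]
  rintro W hW ⟨w, hw⟩
  have : IsLocallyNoetherian Y := LocallyOfFiniteType.isLocallyNoetherian πY
  obtain ⟨_, ⟨V, hV, rfl⟩, hwV, -⟩ := Y.isBasis_affineOpens.exists_subset_of_mem_open
    (Set.mem_univ (pullback.fst πY πX w)) isOpen_univ
  obtain ⟨_, ⟨U, hU, rfl⟩, hwU, -⟩ := X.isBasis_affineOpens.exists_subset_of_mem_open
    (Set.mem_univ (pullback.snd πY πX w)) isOpen_univ
  replace hV : IsAffineOpen V := hV
  replace hU : IsAffineOpen U := hU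
  have hVne : Nonempty V := ⟨⟨_, hwV⟩⟩
  let c : Spec (CommRingCat.of K) := IsLocalRing.closedPoint K
  let y₀ : Y := p₀ c
  let η : Y := genericPoint Y
  have hηV : η ∈ V := ((genericPoint_spec Y).mem_open_set_iff V.isOpen).mpr
    (by simpa using hVne)
  have hspec : η ⤳ y₀ := (genericPoint_spec Y).specializes trivial
  let fA : CommRingCat.of K ⟶ Γ(Y, V) := Spec.preimage (hV.fromSpec ≫ πY)
  let fB : CommRingCat.of K ⟶ Γ(X, U) := Spec.preimage (hU.fromSpec ≫ πX)
  let fR : CommRingCat.of K ⟶ Y.presheaf.stalk y₀ := Spec.preimage (Y.fromSpecStalk y₀ ≫ πY)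
  have hfA : Spec.map fA = hV.fromSpec ≫ πY := Spec.map_preimage _
  have hfB : Spec.map fB = hU.fromSpec ≫ πX := Spec.map_preimage _
  have hfR : Spec.map fR = Y.fromSpecStalk y₀ ≫ πY := Spec.map_preimage _
  let ε : Y.presheaf.stalk y₀ ⟶ CommRingCat.of K := Scheme.stalkClosedPointTo p₀
  have hε0 : Spec.map ε ≫ Y.fromSpecStalk y₀ = p₀ :=
    Scheme.Spec_stalkClosedPointTo_fromSpecStalk p₀
  have hε : fR ≫ ε = 𝟙 _ := by
    apply Spec.map_injective
    rw [Spec.map_comp, hfR, ← Category.assoc, hε0, hp₀, Spec.map_id]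
  let J : Type := {i : I // φ i y₀ ∈ U}
  let ψ : J → (Γ(X, U) ⟶ Y.presheaf.stalk y₀) := fun i =>
    X.presheaf.germ U (φ i.1 y₀) i.2 ≫ (φ i.1).stalkMap y₀
  have hψ0 : ∀ i : J, Spec.map (ψ i) ≫ hU.fromSpec = Y.fromSpecStalk y₀ ≫ φ i.1 := by
    intro i
    rw [Spec.map_comp, Category.assoc, ← Scheme.SpecMap_stalkMap_fromSpecStalk,
      ← hU.fromSpecStalk_eq_fromSpecStalk i.2]
    rfl
  have hψK : ∀ i, fB ≫ ψ i = fR := by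
    intro i
    apply Spec.map_injective
    rw [Spec.map_comp, hfB, hfR, ← Category.assoc, hψ0, Category.assoc, hφ]
  have hψ : ∀ b : Γ(X, U), b ≠ 0 → ∃ i, ε (ψ i b) ≠ 0 := by
    intro b hb
    have hne : (X.basicOpen b : Set X).Nonempty := by
      rw [Set.nonempty_iff_ne_empty]
      intro h
      exact hb ((basicOpen_eq_bot_iff b).mp (TopologicalSpace.Opens.ext h))
    obtain ⟨_, hx, i, s, rfl⟩ := hy₀.inter_open_nonempty _ (X.basicOpen b).isOpen hne
    obtain rfl : s = c := Subsingleton.elim _ _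
    have hx' : φ i y₀ ∈ X.basicOpen b := hx
    have hxU : φ i y₀ ∈ U := X.basicOpen_le b hx'
    refine ⟨⟨i, hxU⟩, ?_⟩
    have hu : IsUnit (X.presheaf.germ U (φ i y₀) hxU b) := (X.mem_basicOpen b _ hxU).mp hx'
    have hu2 := (hu.map ((φ i).stalkMap y₀).hom).map ε.hom
    exact IsUnit.ne_zero (M₀ := K) hu2
  let j : Γ(Y, V) ⟶ Y.functionField := Y.presheaf.germ V η hηV
  have hj : Function.Injective j := germ_injective_of_isIntegral _ _ _
  have hj0 : Spec.map j ≫ hV.fromSpec = Y.fromSpecStalk η :=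
    hV.fromSpecStalk_eq_fromSpecStalk hηV
  let e : Y.presheaf.stalk y₀ ⟶ Y.functionField := Y.presheaf.stalkSpecializes hspec
  have he0 : Spec.map e ≫ Y.fromSpecStalk y₀ = Y.fromSpecStalk η :=
    Scheme.SpecMap_stalkSpecializes_fromSpecStalk hspec
  have hjK : fA ≫ j = fR ≫ e := by
    apply Spec.map_injective
    rw [Spec.map_comp, Spec.map_comp, hfA, hfR, ← Category.assoc, hj0, ← Category.assoc, he0]
  let q : pullback (Spec.map fA) (Spec.map fB) ⟶ pullback πY πX :=
    pullback.map _ _ _ _ hV.fromSpec hU.fromSpec (𝟙 _) (by rw [Category.comp_id, hfA])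
      (by rw [Category.comp_id, hfB])
  have hwq : w ∈ Set.range q := by
    rw [Scheme.Pullback.range_map, hV.range_fromSpec, hU.range_fromSpec]
    exact ⟨hwV, hwU⟩
  obtain ⟨w', hw'⟩ := hwq
  obtain ⟨i, t, ht1, ht2, x, hx⟩ := mid_lemma K _ _ (Y.presheaf.stalk y₀) Y.functionField
    fA fB fR ε hε ψ hψK hψ j hj e rfl hjK (q ⁻¹' W) (hW.preimage q.continuous)
    ⟨w', by rw [Set.mem_preimage, hw']; exact hw⟩
  let γ : Y ⟶ pullback πY πX := pullback.lift (𝟙 Y) (φ i.1) (by rw [Category.id_comp, hφ])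
  have hcomp : t ≫ q = Y.fromSpecStalk η ≫ γ := by
    apply pullback.hom_ext
    · rw [Category.assoc, Category.assoc, pullback.lift_fst, pullback.lift_fst,
        Category.comp_id, ← Category.assoc, ht1, hj0]
    · rw [Category.assoc, Category.assoc, pullback.lift_snd, pullback.lift_snd,
        ← Category.assoc, ht2, Spec.map_comp, Category.assoc, hψ0, ← Category.assoc, he0]
  have hmem : γ (Y.fromSpecStalk η x) ∈ W := by
    rw [← Scheme.Hom.comp_apply, ← hcomp, Scheme.Hom.comp_apply]
    exact hx
  obtain ⟨_, hy, p, hp, s, rfl⟩ := hYK.inter_open_nonempty (γ ⁻¹' W)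
    (hW.preimage γ.continuous) ⟨_, hmem⟩
  exact ⟨_, hy, i.1, p, hp, s, rfl⟩
end

section
/- Let k be an algebraically closed field of characteristic zero, let X and Y be varieties over k, let D be a curve over k, let φ : X → Y be a finite morphism, and let (ψ_i : D → X)_{i ∈ I} be a family of k-morphisms. If the union of graphs ⋃_{i ∈ I} Γ_{φ ∘ ψ_i} is dense in D ×_k Y, then the union of graphs ⋃_{i ∈ I} Γ_{ψ_i} is dense in D ×_k X. -/
open AlgebraicGeometry CategoryTheory CategoryTheory.Limits

/-- The product of two irreducible schemes locally of finite type over an algebraically closed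
field is irreducible. -/
lemma irreducibleSpace_pullback_aux (k : Type) [Field k] [IsAlgClosed k]
    (X D : Scheme) [IsIntegral X] [IsIntegral D]
    (πX : X ⟶ Spec (CommRingCat.of k)) (πD : D ⟶ Spec (CommRingCat.of k))
    [LocallyOfFiniteType πX] [LocallyOfFiniteType πD] :
    IrreducibleSpace (pullback πD πX : Scheme) := by
  have hJ : JacobsonSpace D := LocallyOfFiniteType.jacobsonSpace πD
  have key : ∀ d : D, IsClosed {d} →
      IsIrreducible ((pullback.fst πD πX) ⁻¹' {d}) := by
    intro d hd
    let p := pointOfClosedPoint πD d hd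
    have hp : p ≫ πD = 𝟙 _ := pointOfClosedPoint_comp πD d hd
    let s : X ⟶ pullback πD πX := pullback.lift (πX ≫ p) (𝟙 X) (by simp [hp])
    have hs : IsPullback s πX (pullback.fst πD πX) p := by
      refine IsPullback.of_right (h₁₂ := pullback.snd πD πX) (v₁₃ := πX) (h₂₂ := πD)
        ?_ (pullback.lift_fst _ _ _) (IsPullback.of_hasPullback πD πX).flip
      have h1 : s ≫ pullback.snd πD πX = 𝟙 X := pullback.lift_snd _ _ _
      rw [h1, hp]
      exact IsPullback.of_id_fst
    have h := Scheme.image_preimage_eq_of_isPullback hs.flip Set.univ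
    have h2 : p '' Set.univ = {d} := by
      ext y
      simp only [Set.image_univ, Set.mem_range, Set.mem_singleton_iff]
      constructor
      · rintro ⟨a, rfl⟩
        exact pointOfClosedPoint_apply πD d hd a
      · rintro rfl
        exact ⟨IsLocalRing.closedPoint k, pointOfClosedPoint_apply πD y hd _⟩
    rw [h2, Set.preimage_univ] at h
    rw [← h]
    exact (IrreducibleSpace.isIrreducible_univ X).image _ s.continuous.continuousOn
  have hpre : IsPreirreducible ((pullback.fst πD πX) ⁻¹' Set.univ) := by
    refine IsPreirreducible.preimage_of_dense_isPreirreducible_fiber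
      PreirreducibleSpace.isPreirreducible_univ _ (pullback.fst πD πX).isOpenMap ?_
    have h0 : closedPoints D ⊆ {x | IsPreirreducible ((pullback.fst πD πX) ⁻¹' {x})} :=
      fun d hd ↦ (key d hd).2
    have h1 := closure_mono h0
    rw [closure_closedPoints] at h1
    simpa using h1
  obtain ⟨d, -, hd⟩ := nonempty_inter_closedPoints (X := D) Set.univ_nonempty
    isClosed_univ.isLocallyClosed
  obtain ⟨z, -⟩ := (key d hd).1
  exact { isPreirreducible_univ := by simpa using hpre, toNonempty := ⟨z⟩ }

/-- Let `k` be an algebraically closed field of characteristic zero, let `X`, `Y`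
be varieties over `k`, let `D` be a curve over `k` (a variety of Krull dimension one), let
`φ : X ⟶ Y` be a finite morphism, and let `(ψ i : D ⟶ X)` be a family of `k`-morphisms. If
`⋃ i, Γ_{φ ∘ ψ i}` is dense in `D ×ₖ Y`, then `⋃ i, Γ_{ψ i}` is dense in `D ×ₖ X`. -/
theorem stmt3 (k : Type) [Field k] [IsAlgClosed k] [CharZero k]
    (X Y D : Scheme) [IsIntegral X] [IsIntegral Y] [IsIntegral D]
    (πX : X ⟶ Spec (CommRingCat.of k)) (πY : Y ⟶ Spec (CommRingCat.of k))
    (πD : D ⟶ Spec (CommRingCat.of k))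
    [LocallyOfFiniteType πX] [QuasiCompact πX] [IsSeparated πX]
    [LocallyOfFiniteType πY] [QuasiCompact πY] [IsSeparated πY]
    [LocallyOfFiniteType πD] [QuasiCompact πD] [IsSeparated πD]
    -- `D` is a curve: its Krull dimension is one
    (hD : topologicalKrullDim D = 1)
    (φ : X ⟶ Y) [IsFinite φ] (hφ : φ ≫ πY = πX)
    (I : Type) (ψ : I → (D ⟶ X)) (hψ : ∀ i, ψ i ≫ πX = πD)
    (hdense : Dense (⋃ i : I, Set.range
      (pullback.lift (𝟙 D) (ψ i ≫ φ)
        (by rw [Category.id_comp, Category.assoc, hφ, hψ i]) : D ⟶ pullback πD πY).base)) :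
    Dense (⋃ i : I, Set.range
      (pullback.lift (𝟙 D) (ψ i)
        (by rw [Category.id_comp, hψ i]) : D ⟶ pullback πD πX).base) := by
  have hirr : IrreducibleSpace (pullback πD πX : Scheme) :=
    irreducibleSpace_pullback_aux k X D πX πD
  let f : pullback πD πX ⟶ pullback πD πY :=
    pullback.lift (pullback.fst πD πX) (pullback.snd πD πX ≫ φ)
      (by rw [Category.assoc, hφ, pullback.condition])
  have hf1 : f ≫ pullback.fst πD πY = pullback.fst πD πX := pullback.lift_fst _ _ _
  have hf2 : f ≫ pullback.snd πD πY = pullback.snd πD πX ≫ φ := pullback.lift_snd _ _ _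
  have hf : IsPullback f (pullback.snd πD πX) (pullback.snd πD πY) φ := by
    refine IsPullback.of_right (h₁₂ := pullback.fst πD πY) (v₁₃ := πD) (h₂₂ := πY)
      ?_ (pullback.lift_snd _ _ _) (IsPullback.of_hasPullback πD πY)
    rw [hf1, hφ]
    exact IsPullback.of_hasPullback πD πX
  have hfin : IsFinite f := MorphismProperty.of_isPullback hf.flip inferInstance
  set S := ⋃ i : I, Set.range
      (pullback.lift (𝟙 D) (ψ i)
        (by rw [Category.id_comp, hψ i]) : D ⟶ pullback πD πX).base with hS
  have himg : f '' closure S = Set.univ := by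
    rw [← Set.univ_subset_iff, ← hdense.closure_eq]
    refine closure_minimal ?_ (f.isClosedMap _ isClosed_closure)
    refine Set.iUnion_subset fun i ↦ ?_
    rintro _ ⟨d, rfl⟩
    refine ⟨pullback.lift (𝟙 D) (ψ i) (by rw [Category.id_comp, hψ i]) d,
      subset_closure (Set.mem_iUnion.mpr ⟨i, d, rfl⟩), ?_⟩
    rw [← Scheme.Hom.comp_apply]
    have : pullback.lift (𝟙 D) (ψ i) (by rw [Category.id_comp, hψ i]) ≫ f =
        pullback.lift (𝟙 D) (ψ i ≫ φ)
          (by rw [Category.id_comp, Category.assoc, hφ, hψ i]) := by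
      apply pullback.hom_ext
      · rw [Category.assoc, hf1]
        exact (pullback.lift_fst _ _ _).trans (pullback.lift_fst _ _ _).symm
      · rw [Category.assoc, hf2, ← Category.assoc]
        refine Eq.trans ?_ (pullback.lift_snd _ _ _).symm
        exact congrArg (· ≫ φ) (pullback.lift_snd _ _ _)
    rw [this]
  -- the generic point of the source lies in the closure of `S`
  let ξ := genericPoint (pullback πD πX : Scheme)
  obtain ⟨z, hz, hzξ⟩ : f ξ ∈ f '' closure S := himg ▸ Set.mem_univ _
  have hspec : ξ ⤳ z := genericPoint_specializes z
  have hdisc := f.isDiscrete_preimage_singleton (f ξ)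
  have hEq : ξ = z := by
    have := hdisc.to_subtype
    have h3 : (⟨ξ, rfl⟩ : f ⁻¹' {f ξ}) ⤳ ⟨z, hzξ⟩ :=
      Topology.IsInducing.subtypeVal.specializes_iff.mp hspec
    exact congrArg Subtype.val h3.eq
  rw [dense_iff_closure_eq, ← Set.univ_subset_iff]
  intro w _
  have hξ : ξ ∈ closure S := hEq ▸ hz
  exact (genericPoint_specializes w).mem_closed isClosed_closure hξ
end

section
/- Let K be an infinite field, let L be a finite separable field extension of K of degree m, and let τ_1, …, τ_m : L → K̄ be the m pairwise distinct K-embeddings of L into an algebraic closure K̄ of K. For α ∈ L set P_α = (τ_1(α), …, τ_m(α)) ∈ K̄^m. Then the set R = {P_α | α ∈ L} is Zariski-dense in affine m-space over K̄; that is, for every nonzero polynomial p in m variables with coefficients in K̄ there exists α ∈ L such that p(τ_1(α), …, τ_m(α)) ≠ 0. -/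
/-- Let `K` be an infinite field and `L/K` a finite separable extension of degree
`m`, with `τ 0, …, τ (m-1)` the `m` pairwise distinct `K`-embeddings of `L` into an algebraic
closure `K̄` of `K`. Then the set `{(τ 0 α, …, τ (m-1) α) | α ∈ L}` is Zariski-dense in affine
`m`-space over `K̄`: every nonzero polynomial in `m` variables over `K̄` is nonvanishing at
`(τ 0 α, …, τ (m-1) α)` for some `α ∈ L`. -/
theorem stmt4 (K L Kbar : Type) [Field K] [Infinite K]
    [Field L] [Algebra K L] [FiniteDimensional K L] [Algebra.IsSeparable K L]
    [Field Kbar] [Algebra K Kbar] [IsAlgClosure K Kbar]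
    (m : ℕ) (hm : Module.finrank K L = m)
    (τ : Fin m → (L →ₐ[K] Kbar)) (hτ : Function.Injective τ)
    (p : MvPolynomial (Fin m) Kbar) (hp : p ≠ 0) :
    ∃ α : L, MvPolynomial.eval (fun i => τ i α) p ≠ 0 := by
  classical
  by_contra hcon
  push Not at hcon
  apply hp
  let b : Module.Basis (Fin m) K L := Module.finBasisOfFinrankEq K L hm
  let M : Matrix (Fin m) (Fin m) Kbar := Matrix.of fun i j => τ i (b j)
  have hli : LinearIndependent Kbar (fun i => (τ i).toLinearMap) :=
    (linearIndependent_toLinearMap K L Kbar).comp τ hτ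
  have hM : IsUnit M := by
    rw [← Matrix.linearIndependent_rows_iff_isUnit]
    rw [Fintype.linearIndependent_iff] at hli ⊢
    intro g hg
    apply hli g
    apply b.ext
    intro j
    have := congrFun hg j
    simpa [M, Finset.sum_apply] using this
  haveI : Infinite Kbar := Infinite.of_injective _ (algebraMap K Kbar).injective
  let q : MvPolynomial (Fin m) Kbar :=
    MvPolynomial.bind₁ (fun i => ∑ j, MvPolynomial.C (M i j) * MvPolynomial.X j) p
  have hq : ∀ x : Fin m → Kbar, MvPolynomial.eval x q = MvPolynomial.eval (M.mulVec x) p := by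
    intro x
    have h := MvPolynomial.eval₂Hom_bind₁ (RingHom.id Kbar) x
      (fun i => ∑ j, MvPolynomial.C (M i j) * MvPolynomial.X j) p
    have h2 : (fun i => MvPolynomial.eval₂Hom (RingHom.id Kbar) x
        (∑ j, MvPolynomial.C (M i j) * MvPolynomial.X j)) = M.mulVec x := by
      funext i
      simp [Matrix.mulVec, dotProduct]
    rw [h2] at h
    exact h
  have hq0 : q = 0 := by
    apply MvPolynomial.funext_set (fun _ => Set.range (algebraMap K Kbar))
      (fun _ => Set.infinite_range_of_injective (algebraMap K Kbar).injective)
    intro x hx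
    have hx' : ∀ i, ∃ c : K, algebraMap K Kbar c = x i := fun i => hx i (Set.mem_univ i)
    choose c hc using hx'
    rw [hq, map_zero]
    have h := hcon (∑ j, c j • b j)
    have h3 : (fun i => τ i (∑ j, c j • b j)) = M.mulVec x := by
      funext i
      simp [Matrix.mulVec, dotProduct, M, ← hc, Algebra.smul_def, mul_comm]
    rwa [h3] at h
  apply MvPolynomial.funext
  intro y
  have h := hq (M⁻¹.mulVec y)
  rw [Matrix.mulVec_mulVec, Matrix.mul_nonsing_inv _ ((Matrix.isUnit_iff_isUnit_det M).1 hM),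
    Matrix.one_mulVec, hq0] at h
  rw [← h]
  simp
end

section
/- Let K be an infinite field and let L be a finite Galois extension of K with Galois group G = Gal(L/K). Fix an injective group homomorphism ρ : G → S_m into the symmetric group on {1, …, m}. Then the set of tuples (x_1, …, x_m) ∈ L^m satisfying σ(x_i) = x_{ρ(σ)(i)} for all i = 1, …, m and all σ ∈ G is Zariski-dense in affine m-space over L; that is, for every nonzero polynomial p in m variables with coefficients in L there exists such an equivariant tuple (x_1, …, x_m) ∈ L^m with p(x_1, …, x_m) ≠ 0. (This is the affine formulation of the statement that the set of such Galois-equivariant tuples in (ℙ^1)^m(L) is dense in (ℙ^1)^m; it implies the projective statement since affine m-space is a dense open subvariety of (ℙ^1)^m.) -/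
open Classical in
/-- Coefficients `d` with `∑ k, d k * σ (b k)` equal to `1` at `σ = 1` and `0` otherwise. -/
lemma exists_dual_coeff (K L : Type) [Field K] [Field L] [Algebra K L] [FiniteDimensional K L]
    {κ : Type} [Fintype κ] (b : Module.Basis κ K L) :
    ∃ d : κ → L, ∀ σ : L ≃ₐ[K] L, (∑ k, d k * σ (b k)) = if σ = 1 then 1 else 0 := by
  have hli : LinearIndependent L (fun (σ : L ≃ₐ[K] L) (k : κ) => σ (b k)) := by
    have h0 : LinearIndependent L (fun (σ : L ≃ₐ[K] L) => (σ : L → L)) := by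
      have := (linearIndependent_monoidHom L L).comp
        (fun σ : L ≃ₐ[K] L => ((σ : L →ₐ[K] L) : L →* L)) (by
          intro σ τ h
          ext x
          exact DFunLike.congr_fun h x)
      exact this
    rw [Fintype.linearIndependent_iff] at h0 ⊢
    intro g hg
    apply h0 g
    have hz : (∑ σ : L ≃ₐ[K] L, g σ • (σ.toLinearMap : L →ₗ[K] L)) = 0 := by
      apply b.ext
      intro k
      have := congrFun hg k
      simpa using this
    funext x
    have := LinearMap.congr_fun hz x
    simpa using this
  obtain ⟨f, hf⟩ := LinearMap.exists_extend
    ((Finsupp.lapply (1 : L ≃ₐ[K] L) : _ →ₗ[L] L).comp hli.repr)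
  refine ⟨fun k => f (Pi.single k 1), fun σ => ?_⟩
  have h1 : f (fun k => σ (b k)) = if σ = 1 then 1 else 0 := by
    have := LinearMap.congr_fun hf ⟨_, Submodule.subset_span ⟨σ, rfl⟩⟩
    simp only [LinearMap.comp_apply, Submodule.subtype_apply] at this
    rw [this]
    simp only [Finsupp.lapply_apply]
    rw [hli.repr_eq_single σ _ rfl, Finsupp.single_apply]
  rw [← h1, LinearMap.pi_apply_eq_sum_univ f]
  refine Finset.sum_congr rfl fun k _ => ?_
  rw [smul_eq_mul, mul_comm]
  congr 1
  change f _ = f _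
  congr 1
  funext j
  simp [Pi.single_apply, eq_comm]

/-- Let `K` be an infinite field and `L/K` a finite Galois extension with Galois
group `G = Gal(L/K)`, and fix an injective group homomorphism `ρ : G →* S_m`. Then the set of
Galois-equivariant tuples `(x 0, …, x (m-1)) ∈ L^m` (those with `σ (x i) = x (ρ σ i)` for all
`i` and all `σ ∈ G`) is Zariski-dense in affine `m`-space over `L`: every nonzero polynomial
in `m` variables over `L` is nonvanishing at some such equivariant tuple. -/
theorem stmt5 (K L : Type) [Field K] [Infinite K]
    [Field L] [Algebra K L] [FiniteDimensional K L] [IsGalois K L]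
    (m : ℕ) (ρ : (L ≃ₐ[K] L) →* Equiv.Perm (Fin m)) (hρ : Function.Injective ρ)
    (p : MvPolynomial (Fin m) L) (hp : p ≠ 0) :
    ∃ x : Fin m → L,
      (∀ (i : Fin m) (σ : L ≃ₐ[K] L), σ (x i) = x (ρ σ i)) ∧
      MvPolynomial.eval x p ≠ 0 := by
  classical
  let b := Module.finBasis K L
  obtain ⟨d, hd⟩ := exists_dual_coeff K L b
  let P : Fin m → MvPolynomial (Fin m × Fin (Module.finrank K L)) L := fun i =>
    ∑ σ : L ≃ₐ[K] L, ∑ k, MvPolynomial.C (σ (b k)) * MvPolynomial.X (ρ σ⁻¹ i, k)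
  have hev : ∀ t : Fin m × Fin (Module.finrank K L) → L,
      MvPolynomial.eval t (MvPolynomial.bind₁ P p) =
        MvPolynomial.eval (fun i => ∑ σ : L ≃ₐ[K] L, ∑ k, σ (b k) * t (ρ σ⁻¹ i, k)) p := by
    intro t
    rw [← MvPolynomial.coe_aeval_eq_eval, ← MvPolynomial.coe_aeval_eq_eval]
    simp only [RingHom.coe_coe, MvPolynomial.aeval_bind₁]
    congr 2
    funext i
    simp [P]
  by_contra hcon
  push Not at hcon
  have hq : MvPolynomial.bind₁ P p = 0 := by
    apply MvPolynomial.funext_set (fun _ => Set.range (algebraMap K L))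
      (fun _ => Set.infinite_range_of_injective (algebraMap K L).injective)
    intro t ht
    rw [map_zero, hev]
    apply hcon
    intro i τ
    have ht' : ∀ j, τ (t j) = t j := by
      intro j
      obtain ⟨c, hc⟩ := ht j trivial
      rw [← hc]
      exact τ.commutes c
    rw [map_sum]
    simp only [map_sum, map_mul, ht']
    refine Fintype.sum_equiv (Equiv.mulLeft τ) _ _ fun σ => ?_
    refine Finset.sum_congr rfl fun k _ => ?_
    simp [← Equiv.Perm.mul_apply, ← map_mul]
  apply hp
  have : Infinite L := Infinite.of_injective _ (algebraMap K L).injective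
  apply MvPolynomial.funext
  intro y
  rw [map_zero]
  have h := hev (fun jk => y jk.1 * d jk.2)
  rw [hq, map_zero] at h
  rw [h]
  congr 2
  funext i
  have : ∀ σ : L ≃ₐ[K] L, ∑ k, σ (b k) * (y (ρ σ⁻¹ i) * d k) =
      y (ρ σ⁻¹ i) * if σ = 1 then 1 else 0 := by
    intro σ
    rw [← hd σ, Finset.mul_sum]
    exact Finset.sum_congr rfl fun k _ => by ring
  simp only [this]
  simp
  rfl
end
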